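/- arXiv:1909.04774 — 2 statements merged into one kernel-verified Lean document; each statement's English description precedes it below -/
import Mathlib

section
/- There is a universal constant α > 1 such that the following holds for all positive integers p, k, n with pk ≥ 2. Set r = α · p · log₂(pk). If S_1, …, S_ℓ ⊆ [n] is a sequence of more than r^k sets, each of size exactly k, and the sequence is r-spread, then there exist p indices i_1 < i_2 < … < i_p such that the sets S_{i_1}, …, S_{i_p} are pairwise disjoint. -/
open Finset

section Fragments

variable {α ι C : Type*}

section Minimal

variable [DecidableEq α] [Fintype ι]

/-- For a family `F` and a set `W`, every member `F i` of size less than `K` contains a set of the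
form `F j \ W`, with `F j` of size less than `K`, which is smallest among all sets of this form
contained in `F i`. -/
theorem exists_minimal_fragment (F : ι → Finset α) (W : Finset α) (K : ℕ) (i : ι) :
    ∃ A : Finset α, A ⊆ F i \ W ∧ (∃ j, F j \ W = A ∧ (#(F i) < K → #(F j) < K)) ∧
      (#(F i) < K → ∀ j, #(F j) < K → F j ⊆ F i ∪ W → #A ≤ #(F j \ W)) := by
  by_cases hi : #(F i) < K
  · obtain ⟨j, hj, hmin⟩ := exists_min_image
      (univ.filter fun j => #(F j) < K ∧ F j ⊆ F i ∪ W) (fun j => #(F j \ W))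
      ⟨i, by simp [hi]⟩
    simp only [mem_filter, mem_univ, true_and] at hj hmin
    refine ⟨F j \ W, ?_, ⟨j, rfl, fun _ => hj.1⟩, fun _ j' h₁ h₂ => hmin j' ⟨h₁, h₂⟩⟩
    intro x hx
    have hxj := hj.2 (mem_sdiff.1 hx).1
    simp only [mem_sdiff, mem_union] at hx hxj ⊢
    tauto
  · exact ⟨F i \ W, Subset.rfl, ⟨i, rfl, fun h => h⟩, fun h => absurd h hi⟩

/-- A choice of minimal fragment, see `exists_minimal_fragment`. -/
noncomputable def fragment (F : ι → Finset α) (W : Finset α) (K : ℕ) (i : ι) : Finset α :=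
  (exists_minimal_fragment F W K i).choose

theorem fragment_subset (F : ι → Finset α) (W : Finset α) (K : ℕ) (i : ι) :
    fragment F W K i ⊆ F i \ W :=
  (exists_minimal_fragment F W K i).choose_spec.1

theorem exists_sdiff_eq_fragment (F : ι → Finset α) (W : Finset α) (K : ℕ) (i : ι) :
    ∃ j, F j \ W = fragment F W K i ∧ (#(F i) < K → #(F j) < K) :=
  (exists_minimal_fragment F W K i).choose_spec.2.1

theorem card_fragment_le {F : ι → Finset α} {W : Finset α} {K : ℕ} {i j : ι}
    (hi : #(F i) < K) (hj : #(F j) < K) (hsub : F j ⊆ F i ∪ W) :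
    #(fragment F W K i) ≤ #(F j \ W) :=
  (exists_minimal_fragment F W K i).choose_spec.2.2 hi j hj hsub

/-- A small member of a family inside the union of `W` and a minimal fragment contains the
fragment. -/
theorem fragment_subset_of_subset_union {F : ι → Finset α} {W : Finset α} {K : ℕ} {i j : ι}
    (hi : #(F i) < K) (hj : #(F j) < K) (hsub : F j ⊆ W ∪ fragment F W K i) :
    fragment F W K i ⊆ F j := by
  have hfrag := fragment_subset F W K i
  have hle : #(fragment F W K i) ≤ #(F j \ W) := by
    refine card_fragment_le hi hj fun x hx => ?_
    rcases mem_union.1 (hsub hx) with h | h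
    · exact mem_union_right _ h
    · exact mem_union_left _ (mem_sdiff.1 (hfrag h)).1
  have hsub' : F j \ W ⊆ fragment F W K i := by
    intro x hx
    have := hsub (mem_sdiff.1 hx).1
    simp only [mem_sdiff, mem_union] at hx this
    tauto
  rw [← eq_of_subset_of_card_le hsub' hle]
  exact sdiff_subset

/-- Given `F` and `V`, some set `R` of size at most `K` contains every minimal fragment
`fragment F W K i` of a small member `F i` for which `W ∪ fragment F W K i = V`. -/
theorem exists_fragment_cover (F : ι → Finset α) (V : Finset α) (K : ℕ) :
    ∃ R : Finset α, #R ≤ K ∧ ∀ W i, #(F i) < K → W ∪ fragment F W K i = V →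
      fragment F W K i ⊆ R := by
  by_cases h : ∃ j, #(F j) < K ∧ F j ⊆ V
  · obtain ⟨j, hj, hjV⟩ := h
    refine ⟨F j, hj.le, fun W i hi hV => ?_⟩
    exact fragment_subset_of_subset_union hi hj (hV ▸ hjV)
  · refine ⟨∅, by simp, fun W i hi hV => absurd ?_ h⟩
    obtain ⟨j, hj, hjK⟩ := exists_sdiff_eq_fragment F W K i
    refine ⟨j, hjK hi, ?_⟩
    rw [← hV, ← hj]
    intro x hx
    simp only [mem_sdiff, mem_union]
    tauto

end Minimal

/-- The elements of colour `c`. -/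
def colorClass [Fintype α] [DecidableEq C] (χ : α → C) (c : C) : Finset α := univ.filter fun x => χ x = c

/-- Recolour all elements of `A` with `c`. -/
def recolor [DecidableEq α] (χ : α → C) (A : Finset α) (c : C) : α → C :=
  fun x => if x ∈ A then c else χ x

theorem card_recolor_fiber_le [Fintype α] [DecidableEq α] [Fintype C] [DecidableEq C]
    (A : Finset α) (c : C) (χ' : α → C) :
    #(univ.filter fun χ : α → C => recolor χ A c = χ') ≤ Fintype.card C ^ #A := by
  have hcard : Fintype.card C ^ #A = #(univ : Finset (A → C)) := by simp
  rw [hcard]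
  refine card_le_card_of_injOn (fun χ x => χ x) (fun _ _ => mem_coe.2 (mem_univ _)) ?_
  intro χ₁ h₁ χ₂ h₂ heq
  simp only [coe_filter, mem_univ, true_and, Set.mem_ofPred_eq] at h₁ h₂
  funext x
  by_cases hx : x ∈ A
  · exact congrFun heq ⟨x, hx⟩
  · have := congrFun (h₁.trans h₂.symm) x
    simpa [recolor, hx] using this

/-- `T` assigns to every colouring `χ` residues `T χ i` of the sets `S i`: what remains of them
after the colours in `D` have been exposed. -/
structure IsResidue (S : ι → Finset α) (D : Finset C) (T : (α → C) → ι → Finset α) : Prop where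
  congr : ∀ χ χ' : α → C, (∀ x, χ x ∈ D ∨ χ' x ∈ D → χ x = χ' x) → T χ = T χ'
  subset : ∀ χ i, T χ i ⊆ S i
  notMem : ∀ χ i, ∀ x ∈ T χ i, χ x ∉ D
  exists_subset : ∀ χ i, ∃ j, ∀ x ∈ S j, x ∈ T χ i ∨ χ x ∈ D

theorem isResidue_empty (S : ι → Finset α) : IsResidue S (∅ : Finset C) fun _ => S :=
  ⟨fun _ _ _ => rfl, fun _ _ => Subset.rfl, by simp, fun _ i => ⟨i, fun _ h => Or.inl h⟩⟩

variable [Fintype α] [DecidableEq α] [Fintype ι] [DecidableEq C]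

/-- Exposing the colour `c` and passing to minimal fragments. -/
theorem IsResidue.insert {S : ι → Finset α} {D : Finset C} {T : (α → C) → ι → Finset α}
    (hT : IsResidue S D T) (c : C) (K : ℕ) :
    IsResidue S (insert c D) fun χ => fragment (T χ) (colorClass χ c) K where
  congr χ χ' h := by
    have hTT : T χ = T χ' := hT.congr χ χ' fun x hx => h x (by
      rcases hx with hx | hx <;> simp [hx])
    have hW : colorClass χ c = colorClass χ' c := by
      ext x
      simp only [colorClass, mem_filter, mem_univ, true_and]
      constructor
      · intro hx
        rw [← h x (Or.inl (by simp [hx])), hx]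
      · intro hx
        rw [h x (Or.inr (by simp [hx])), hx]
    simp only [hTT, hW]
  subset χ i := ((fragment_subset _ _ _ _).trans sdiff_subset).trans (hT.subset χ i)
  notMem χ i x hx := by
    have h := mem_sdiff.1 (fragment_subset _ _ _ _ hx)
    have hD := hT.notMem χ i x h.1
    have hc : χ x ≠ c := by simpa [colorClass] using h.2
    simp [hD, hc]
  exists_subset χ i := by
    obtain ⟨j, hj, -⟩ := exists_sdiff_eq_fragment (T χ) (colorClass χ c) K i
    obtain ⟨l, hl⟩ := hT.exists_subset χ j
    refine ⟨l, fun x hx => ?_⟩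
    rw [← hj]
    have := hl x hx
    simp only [mem_sdiff, colorClass, mem_filter, mem_univ, true_and, mem_insert]
    tauto

variable [Fintype C]

/-- Few pairs of a colouring and an index have a small residue but a large minimal fragment. -/
theorem IsResidue.card_large_fragment_le {S : ι → Finset α} {D : Finset C}
    {T : (α → C) → ι → Finset α} (hT : IsResidue S D T) {c : C} (hc : c ∉ D) {M r : ℝ}
    (hM : 0 ≤ M) (hr : 0 < r) (hrC : Fintype.card C ≤ r)
    (hS : ∀ Z : Finset α, Z.Nonempty → (#(univ.filter fun i => Z ⊆ S i) : ℝ) ≤ M / r ^ #Z)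
    {h : ℕ} (hh : 0 < h) :
    (#(univ.filter fun q : (α → C) × ι => #(T q.1 q.2) < 2 * h ∧
      h ≤ #(fragment (T q.1) (colorClass q.1 c) (2 * h) q.2)) : ℝ) ≤
      M * Fintype.card (α → C) * (4 * Fintype.card C / r) ^ h := by
  choose R hRcard hR using fun χ : α → C =>
    exists_fragment_cover (T χ) (colorClass χ c) (2 * h)
  set A : (α → C) × ι → Finset α :=
    fun q => fragment (T q.1) (colorClass q.1 c) (2 * h) q.2 with hA
  set B := univ.filter fun q : (α → C) × ι => #(T q.1 q.2) < 2 * h ∧ h ≤ #(A q) with hB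
  set P : Finset ((α → C) × Finset α) :=
    univ.filter fun q => q.2 ⊆ R q.1 ∧ h ≤ #q.2 with hP
  have hmap : ∀ q ∈ B, (recolor q.1 (A q) c, A q) ∈ P := by
    intro q hq
    simp only [hB, mem_filter, mem_univ, true_and] at hq
    simp only [hP, mem_filter, mem_univ, true_and]
    refine ⟨?_, hq.2⟩
    have hAT : A q ⊆ T q.1 q.2 := (fragment_subset _ _ _ _).trans sdiff_subset
    have hcongr : T (recolor q.1 (A q) c) = T q.1 := by
      refine hT.congr _ _ fun x hx => ?_
      by_cases hxA : x ∈ A q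
      · have := hT.notMem _ _ x (hAT hxA)
        simp [recolor, hxA, hc, this] at hx
      · simp [recolor, hxA]
    have hV : colorClass q.1 c ∪ A q = colorClass (recolor q.1 (A q) c) c := by
      ext x
      by_cases hxA : x ∈ A q <;> simp [colorClass, recolor, hxA]
    have := hR (recolor q.1 (A q) c) (colorClass q.1 c) q.2
    rw [hcongr] at this
    exact this hq.1 hV
  have hfiber : ∀ y ∈ P, (#(B.filter fun q => (recolor q.1 (A q) c, A q) = y) : ℝ) ≤
      M * (Fintype.card C / r) ^ h := by
    rintro ⟨χ', Z⟩ hy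
    simp only [hP, mem_filter, mem_univ, true_and] at hy
    have hZ : Z.Nonempty := card_pos.1 (hh.trans_le hy.2)
    have hsub : (B.filter fun q => (recolor q.1 (A q) c, A q) = (χ', Z)) ⊆
        (univ.filter fun χ : α → C => recolor χ Z c = χ') ×ˢ
          (univ.filter fun i => Z ⊆ S i) := by
      intro q hq
      simp only [mem_filter, Prod.mk.injEq] at hq
      obtain ⟨-, h₁, h₂⟩ := hq
      simp only [mem_product, mem_filter, mem_univ, true_and]
      rw [← h₂]
      exact ⟨h₁, ((fragment_subset _ _ _ _).trans sdiff_subset).trans (hT.subset _ _)⟩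
    have h₁ : (#(univ.filter fun χ : α → C => recolor χ Z c = χ') : ℝ) ≤
        (Fintype.card C : ℝ) ^ #Z := mod_cast card_recolor_fiber_le Z c χ'
    have h₃ := card_le_card hsub
    rw [card_product] at h₃
    calc (#(B.filter fun q => (recolor q.1 (A q) c, A q) = (χ', Z)) : ℝ)
        ≤ #(univ.filter fun χ : α → C => recolor χ Z c = χ') *
            #(univ.filter fun i => Z ⊆ S i) := mod_cast h₃
      _ ≤ (Fintype.card C : ℝ) ^ #Z * (M / r ^ #Z) :=
          mul_le_mul h₁ (hS Z hZ) (by positivity) (by positivity)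
      _ = M * (Fintype.card C / r) ^ #Z := by rw [div_pow]; ring
      _ ≤ M * (Fintype.card C / r) ^ h :=
          mul_le_mul_of_nonneg_left
            (pow_le_pow_of_le_one (by positivity) ((div_le_one hr).2 hrC) hy.2) hM
  have hPcard : (#P : ℝ) ≤ Fintype.card (α → C) * 4 ^ h := by
    have hsub : P ⊆ univ.biUnion fun χ => {χ} ×ˢ (R χ).powerset := by
      intro q hq
      simp only [hP, mem_filter, mem_univ, true_and] at hq
      simp only [mem_biUnion, mem_univ, true_and, mem_product, mem_singleton, mem_powerset]
      exact ⟨q.1, rfl, hq.1⟩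
    have : #P ≤ Fintype.card (α → C) * 4 ^ h := by
      refine (card_le_card hsub).trans (card_biUnion_le_card_mul _ _ _ fun χ _ => ?_)
      rw [card_product, card_singleton, one_mul, card_powerset]
      calc 2 ^ #(R χ) ≤ 2 ^ (2 * h) := Nat.pow_le_pow_right (by norm_num) (hRcard χ)
        _ = 4 ^ h := by rw [pow_mul]; norm_num
    exact_mod_cast this
  calc (#B : ℝ) = ∑ y ∈ P, (#(B.filter fun q => (recolor q.1 (A q) c, A q) = y) : ℝ) := by
        rw [card_eq_sum_card_fiberwise hmap]; push_cast; rfl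
    _ ≤ ∑ _y ∈ P, M * (Fintype.card C / r) ^ h := sum_le_sum hfiber
    _ = #P * (M * (Fintype.card C / r) ^ h) := by rw [sum_const, nsmul_eq_mul]
    _ ≤ (Fintype.card (α → C) * 4 ^ h) * (M * (Fintype.card C / r) ^ h) :=
        mul_le_mul_of_nonneg_right hPcard (by positivity)
    _ = M * Fintype.card (α → C) * (4 * Fintype.card C / r) ^ h := by
        rw [mul_div_assoc, mul_pow]; ring

/-- After exposing the colours of `D`, most residues have size less than `2 ^ (m - #D)`. -/
theorem exists_isResidue_card_le {S : ι → Finset α} {M r : ℝ} (hM : 0 ≤ M) (hr : 0 < r)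
    (hrC : 16 * Fintype.card C ≤ r)
    (hS : ∀ Z : Finset α, Z.Nonempty → (#(univ.filter fun i => Z ⊆ S i) : ℝ) ≤ M / r ^ #Z)
    {m : ℕ} (hm : ∀ i, #(S i) < 2 ^ m) (D : Finset C) (hD : #D ≤ m) :
    ∃ T : (α → C) → ι → Finset α, IsResidue S D T ∧
      (#(univ.filter fun q : (α → C) × ι => 2 ^ (m - #D) ≤ #(T q.1 q.2)) : ℝ) ≤
        M * Fintype.card (α → C) * ((1 / 4) ^ (m - #D) / 3) := by
  induction D using Finset.induction_on with
  | empty =>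
    refine ⟨_, isResidue_empty S, ?_⟩
    rw [filter_eq_empty_iff.2]
    · simp only [card_empty, Nat.cast_zero]; positivity
    · intro q _
      simpa using hm q.2
  | insert c D hc ih =>
    rw [card_insert_of_notMem hc] at hD ⊢
    obtain ⟨T, hT, hcard⟩ := ih (by omega)
    obtain ⟨e, he⟩ : ∃ e, m - #D = e + 1 := ⟨m - #D - 1, by omega⟩
    have he' : m - (#D + 1) = e := by omega
    rw [he] at hcard
    rw [he']
    refine ⟨_, hT.insert c (2 * 2 ^ e), ?_⟩
    have hCr : (Fintype.card C : ℝ) ≤ r := by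
      have : (0 : ℝ) ≤ Fintype.card C := by positivity
      linarith
    have hstep := hT.card_large_fragment_le hc hM hr hCr hS (h := 2 ^ e) (by positivity)
    have hpow : (4 * Fintype.card C / r : ℝ) ^ 2 ^ e ≤ (1 / 4) ^ (e + 1) := by
      have h₁ : (4 * Fintype.card C / r : ℝ) ≤ 1 / 4 := by
        rw [div_le_iff₀ hr]; linarith
      calc (4 * Fintype.card C / r : ℝ) ^ 2 ^ e ≤ (1 / 4) ^ 2 ^ e :=
            pow_le_pow_left₀ (by positivity) h₁ _
        _ ≤ (1 / 4) ^ (e + 1) :=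
            pow_le_pow_of_le_one (by norm_num) (by norm_num) Nat.lt_two_pow_self
    classical
    have hsub : (univ.filter fun q : (α → C) × ι =>
          2 ^ e ≤ #(fragment (T q.1) (colorClass q.1 c) (2 * 2 ^ e) q.2)) ⊆
        (univ.filter fun q : (α → C) × ι => 2 ^ (e + 1) ≤ #(T q.1 q.2)) ∪
        (univ.filter fun q : (α → C) × ι => #(T q.1 q.2) < 2 * 2 ^ e ∧
          2 ^ e ≤ #(fragment (T q.1) (colorClass q.1 c) (2 * 2 ^ e) q.2)) := by
      intro q hq
      simp only [mem_filter, mem_univ, true_and, mem_union, pow_succ'] at hq ⊢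
      rcases lt_or_ge #(T q.1 q.2) (2 * 2 ^ e) with h | h
      · exact Or.inr ⟨h, hq⟩
      · exact Or.inl h
    have hle := (card_le_card hsub).trans (card_union_le _ _)
    have hle' : (#(univ.filter fun q : (α → C) × ι =>
          2 ^ e ≤ #(fragment (T q.1) (colorClass q.1 c) (2 * 2 ^ e) q.2)) : ℝ) ≤
        #(univ.filter fun q : (α → C) × ι => 2 ^ (e + 1) ≤ #(T q.1 q.2)) +
        #(univ.filter fun q : (α → C) × ι => #(T q.1 q.2) < 2 * 2 ^ e ∧
          2 ^ e ≤ #(fragment (T q.1) (colorClass q.1 c) (2 * 2 ^ e) q.2)) := mod_cast hle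
    have hMC : (0 : ℝ) ≤ M * Fintype.card (α → C) := by positivity
    have hlast := mul_le_mul_of_nonneg_left hpow hMC
    refine hle'.trans ((add_le_add hcard (hstep.trans hlast)).trans (le_of_eq ?_))
    rw [pow_succ]; ring

/-- A uniformly random colouring has, with probability at least `2 / 3`, a member of the spread
family `S` all of whose elements have colours in `D`. -/
theorem three_mul_card_forall_not_subset_le {S : ι → Finset α} {M r : ℝ} (hM : 0 ≤ M)
    (hr : 0 < r) (hMι : M < Fintype.card ι) (hrC : 16 * Fintype.card C ≤ r)
    (hS : ∀ Z : Finset α, Z.Nonempty → (#(univ.filter fun i => Z ⊆ S i) : ℝ) ≤ M / r ^ #Z)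
    {m : ℕ} (hm : ∀ i, #(S i) < 2 ^ m) (D : Finset C) (hD : #D = m) :
    3 * #(univ.filter fun χ : α → C => ∀ i, ¬ ∀ x ∈ S i, χ x ∈ D) ≤ Fintype.card (α → C) := by
  obtain ⟨T, hT, hcard⟩ := exists_isResidue_card_le hM hr hrC hS hm D hD.le
  have hsub : (univ.filter fun χ : α → C => ∀ i, ¬ ∀ x ∈ S i, χ x ∈ D) ×ˢ (univ : Finset ι) ⊆
      univ.filter fun q : (α → C) × ι => 2 ^ (m - #D) ≤ #(T q.1 q.2) := by
    rintro ⟨χ, i⟩ hq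
    simp only [mem_product, mem_filter, mem_univ, true_and, and_true] at hq ⊢
    rw [hD, Nat.sub_self, pow_zero, Nat.one_le_iff_ne_zero, Ne, card_eq_zero]
    intro h₀
    obtain ⟨j, hj⟩ := hT.exists_subset χ i
    exact hq j fun x hx => by simpa [h₀] using hj x hx
  have hle := card_le_card hsub
  rw [card_product, card_univ] at hle
  have hle' : (#(univ.filter fun χ : α → C => ∀ i, ¬ ∀ x ∈ S i, χ x ∈ D) : ℝ) *
      Fintype.card ι ≤ M * Fintype.card (α → C) * ((1 / 4) ^ (m - #D) / 3) :=
    le_trans (mod_cast hle) hcard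
  rw [hD, Nat.sub_self, pow_zero] at hle'
  have hι : (0 : ℝ) < Fintype.card ι := hM.trans_lt hMι
  have hN : (0 : ℝ) ≤ Fintype.card (α → C) := by positivity
  have : (3 * #(univ.filter fun χ : α → C => ∀ i, ¬ ∀ x ∈ S i, χ x ∈ D) : ℝ) ≤
      Fintype.card (α → C) := by
    refine le_of_mul_le_mul_right ?_ hι
    have := mul_le_mul_of_nonneg_right hMι.le hN
    nlinarith
  exact_mod_cast this

/-- If `16 * (2 * p * m) ≤ r`, then a family of more than `M` sets of size less than `2 ^ m` that
is spread with parameters `M` and `r` has members inside `p` disjoint parts of the ground set. -/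
theorem exists_coloring_of_spread {S : ι → Finset α} {M r : ℝ} (hM : 0 ≤ M) (hr : 0 < r)
    (hMι : M < Fintype.card ι) {p m : ℕ} (hp : 0 < p) (hm₀ : 0 < m)
    (hrC : 16 * (2 * p * m) ≤ r)
    (hS : ∀ Z : Finset α, Z.Nonempty → (#(univ.filter fun i => Z ⊆ S i) : ℝ) ≤ M / r ^ #Z)
    (hm : ∀ i, #(S i) < 2 ^ m) :
    ∃ (g : α → Fin (2 * p)) (G : Finset (Fin (2 * p))), #G = p ∧
      ∀ a ∈ G, ∃ i, ∀ x ∈ S i, g x = a := by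
  have : NeZero (2 * p) := ⟨by omega⟩
  have : NeZero m := ⟨by omega⟩
  let bad : (α → Fin (2 * p) × Fin m) → Fin (2 * p) → Prop :=
    fun χ a => ∀ i, ¬ ∀ x ∈ S i, χ x ∈ ({a} ×ˢ univ : Finset (Fin (2 * p) × Fin m))
  classical
  have hbad : ∀ a, 3 * #(univ.filter fun χ => bad χ a) ≤
      Fintype.card (α → Fin (2 * p) × Fin m) := fun a =>
    three_mul_card_forall_not_subset_le hM hr hMι (by simpa using hrC) hS hm _ (by simp)
  obtain ⟨χ, hχ⟩ : ∃ χ, 3 * #(univ.filter fun a => bad χ a) ≤ 2 * p := by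
    by_contra! hcon
    have h₁ : ∑ χ, #(univ.filter fun a => bad χ a) = ∑ a, #(univ.filter fun χ => bad χ a) :=
      sum_card_bipartiteAbove_eq_sum_card_bipartiteBelow bad
    have h₂ : ∑ a, 3 * #(univ.filter fun χ => bad χ a) ≤
        2 * p * Fintype.card (α → Fin (2 * p) × Fin m) := by
      simpa using sum_le_card_nsmul univ _ _ fun a _ => hbad a
    have h₃ : Fintype.card (α → Fin (2 * p) × Fin m) * (2 * p) <
        ∑ χ, 3 * #(univ.filter fun a => bad χ a) := by
      have := sum_lt_sum_of_nonempty (univ_nonempty (α := α → Fin (2 * p) × Fin m))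
        fun χ _ => hcon χ
      rwa [sum_const, card_univ, smul_eq_mul] at this
    rw [← mul_sum] at h₂ h₃
    rw [h₁] at h₃
    linarith
  have hgood : p ≤ #(univ.filter fun a => ¬ bad χ a) := by
    have := card_filter_add_card_filter_not (s := univ) (fun a => bad χ a)
    rw [card_univ, Fintype.card_fin] at this
    omega
  obtain ⟨G, hG, hGp⟩ := exists_subset_card_eq hgood
  refine ⟨fun x => (χ x).1, G, hGp, fun a ha => ?_⟩
  have := (mem_filter.1 (hG ha)).2
  obtain ⟨i, hi⟩ := not_forall.1 this
  rw [not_not] at hi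
  exact ⟨i, fun x hx => mem_singleton.1 (mem_product.1 (hi x hx)).1⟩

end Fragments

/-- **Spread lemma** (Lemma 2 of the paper).
There is a universal constant `α > 1` such that: for all positive `p k n` with
`p * k ≥ 2`, setting `r = α * p * log₂ (p * k)`, every `r`-spread sequence
`S : Fin ℓ → Finset (Fin n)` of more than `r ^ k` sets, each of size exactly `k`,
contains `p` (indexwise increasing) pairwise disjoint sets. -/
theorem spread_lemma :
    ∃ α : ℝ, 1 < α ∧
      ∀ (p k n ℓ : ℕ) (S : Fin ℓ → Finset (Fin n)),
        0 < p → 0 < k → 0 < n → 2 ≤ p * k →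
        (∀ i, (S i).card = k) →
        -- the sequence is r-spread, where r = α * p * log₂ (p * k)
        (∀ Z : Finset (Fin n), Z.Nonempty →
          (((Finset.univ.filter (fun i : Fin ℓ => Z ⊆ S i)).card : ℝ) ≤
            (α * p * Real.logb 2 (p * k)) ^ (k - Z.card))) →
        -- more than r ^ k sets
        (α * p * Real.logb 2 (p * k)) ^ k < (ℓ : ℝ) →
        ∃ f : Fin p → Fin ℓ, StrictMono f ∧
          ∀ i j, i ≠ j → Disjoint (S (f i)) (S (f j)) := by
  refine ⟨64, by norm_num, ?_⟩
  intro p k n ℓ S hp hk _ hpk hcard hspread hℓ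
  set L : ℝ := Real.logb 2 (p * k) with hL
  set r : ℝ := 64 * p * L with hr
  have hpk' : (2 : ℝ) ≤ p * k := mod_cast hpk
  have hp₁ : (1 : ℝ) ≤ p := mod_cast hp
  have hk₁ : (1 : ℝ) ≤ k := mod_cast hk
  have hL₁ : 1 ≤ L := by
    rw [hL, Real.le_logb_iff_rpow_le (by norm_num) (by linarith)]
    simpa using hpk'
  have hr₀ : 0 < r := by positivity
  have hlog : (Nat.log 2 k : ℝ) ≤ L := by
    rw [hL, Real.le_logb_iff_rpow_le (by norm_num) (by linarith), Real.rpow_natCast]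
    have h₁ : ((2 ^ Nat.log 2 k : ℕ) : ℝ) ≤ k := mod_cast Nat.pow_log_le_self 2 hk.ne'
    push_cast at h₁
    nlinarith
  have hS : ∀ Z : Finset (Fin n), Z.Nonempty →
      (#(univ.filter fun i => Z ⊆ S i) : ℝ) ≤ r ^ k / r ^ #Z := by
    intro Z hZ
    by_cases hZk : #Z ≤ k
    · rw [div_eq_mul_inv, ← pow_sub₀ r hr₀.ne' hZk]
      exact hspread Z hZ
    · rw [filter_eq_empty_iff.2]
      · simp only [card_empty, Nat.cast_zero]; positivity
      · intro i _ hi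
        exact hZk (hcard i ▸ card_le_card hi)
  obtain ⟨g, G, hG, hgG⟩ := exists_coloring_of_spread (S := S) (m := Nat.log 2 k + 1)
    (pow_nonneg hr₀.le k) hr₀ (by simpa using hℓ) hp (Nat.succ_pos _)
    (by push_cast; rw [hr]; nlinarith) hS
    (fun i => by rw [hcard i]; exact Nat.lt_pow_succ_log_self (by norm_num) k)
  have : Nonempty (Fin ℓ) := by
    refine ⟨⟨0, ?_⟩⟩
    exact_mod_cast (pow_nonneg hr₀.le k).trans_lt hℓ
  choose! s hs using hgG
  have hinj : Set.InjOn s G := by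
    intro a ha b hb hab
    obtain ⟨x, hx⟩ : (S (s a)).Nonempty := card_pos.1 (by rw [hcard]; exact hk)
    rw [← hs a ha x hx, hs b hb x (hab ▸ hx)]
  have hcardG : #(G.image s) = p := by rw [card_image_of_injOn hinj, hG]
  refine ⟨(G.image s).orderEmbOfFin hcardG, OrderEmbedding.strictMono _, fun i j hij => ?_⟩
  obtain ⟨a, ha, hai⟩ := mem_image.1 ((G.image s).orderEmbOfFin_mem hcardG i)
  obtain ⟨b, hb, hbj⟩ := mem_image.1 ((G.image s).orderEmbOfFin_mem hcardG j)
  rw [← hai, ← hbj, disjoint_left]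
  intro x hxa hxb
  have hab : a = b := (hs a ha x hxa).symm.trans (hs b hb x hxb)
  refine hij (((G.image s).orderEmbOfFin hcardG).injective ?_)
  rw [← hai, ← hbj, hab]
end

section
/- There are universal constants β > 1 and κ > 1 such that the following holds. Let 0 < γ < 1/2 and 0 < ε < 1/2, let k, n be positive integers, and set r = β · (1/γ) · log₂(k/ε). Suppose S_1, …, S_ℓ ⊆ [n] is an r-spread sequence of ℓ = ⌈r^k⌉ sets, each of size exactly k. Then for every integer m with 0 ≤ m ≤ rγ/κ, if X is uniformly distributed on [ℓ] and W ⊆ [n] is an independent uniformly random set of a fixed size that is at least κ·m·n/r, then E[f(X, W)] ≤ k · (2/3)^m. -/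
/-- `f x W = min { |S y \ W| : y, S y ⊆ S x ∪ W }`.  The set of candidate values is
nonempty since `y = x` always qualifies, so `Nat.sInf` is this minimum. -/
noncomputable def chiCard {n ℓ : ℕ} (S : Fin ℓ → Finset (Fin n)) (x : Fin ℓ)
    (W : Finset (Fin n)) : ℕ :=
  sInf {m : ℕ | ∃ y : Fin ℓ, S y ⊆ S x ∪ W ∧ (S y \ W).card = m}

/-- Every `x` and `V` admit a residual `T x V = A y \ V ⊆ A x` which is contained in a set
`B (V ∪ T x V)` of size at most `|A x|` depending only on the union `V ∪ T x V`. -/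
theorem exists_residual {α ι : Type*} [DecidableEq α] (A : ι → Finset α) :
    ∃ (T : ι → Finset α → Finset α) (B : Finset α → Finset α), ∀ x V,
      T x V ⊆ A x ∧ Disjoint (T x V) V ∧ T x V ⊆ B (V ∪ T x V) ∧
      (B (V ∪ T x V)).card ≤ (A x).card ∧ ∃ y, A y ⊆ A x ∪ V ∧ A y \ V = T x V := by
  have hB : ∀ R : Finset α, ∃ D : Finset α, ∀ y, A y ⊆ R →
      ∃ z, D = A z ∧ A z ⊆ R ∧ D.card ≤ (A y).card := by
    intro R
    by_cases h : ∃ y, A y ⊆ R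
    · obtain ⟨z, hz, hmin⟩ := exists_minimalFor_of_wellFoundedLT (fun y => A y ⊆ R)
        (fun y => (A y).card) h
      refine ⟨A z, fun y hy => ⟨z, rfl, hz, ?_⟩⟩
      exact (le_total _ _).elim id (hmin hy)
    · exact ⟨∅, fun y hy => (h ⟨y, hy⟩).elim⟩
  choose B hB using hB
  have hY : ∀ x V, ∃ y, (A y ⊆ A x ∪ V ∧ (A y).card ≤ (A x).card) ∧
      ∀ z, A z ⊆ A x ∪ V → (A z).card ≤ (A x).card → (A y \ V).card ≤ (A z \ V).card := by
    intro x V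
    obtain ⟨y, hy, hmin⟩ := exists_minimalFor_of_wellFoundedLT
      (fun y => A y ⊆ A x ∪ V ∧ (A y).card ≤ (A x).card) (fun y => (A y \ V).card)
      ⟨x, Finset.subset_union_left, le_rfl⟩
    exact ⟨y, hy, fun z hz hz' => (le_total _ _).elim id (hmin ⟨hz, hz'⟩)⟩
  choose Y hY hmin using hY
  refine ⟨fun x V => A (Y x V) \ V, B, fun x V => ?_⟩
  obtain ⟨hsub, hcard⟩ := hY x V
  have hT : A (Y x V) \ V ⊆ A x := by
    exact sdiff_le_iff.2 (by rw [sup_comm]; exact hsub)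
  obtain ⟨z, hz, hzR, hzc⟩ := hB (V ∪ A (Y x V) \ V) (Y x V) (by
    rw [Finset.union_sdiff_self_eq_union]; exact Finset.subset_union_right)
  have hzT : A z \ V ⊆ A (Y x V) \ V := sdiff_le_iff.2 hzR
  have hzx : A z ⊆ A x ∪ V := by
    rw [Finset.union_comm]; exact sdiff_le_iff.1 (hzT.trans hT)
  have heq := Finset.eq_of_subset_of_card_le hzT
    (hmin x V z hzx ((hz ▸ hzc).trans hcard))
  refine ⟨hT, Finset.sdiff_disjoint, ?_, hzc.trans hcard, Y x V, hsub, rfl⟩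
  rw [hz]
  exact heq.symm.subset.trans Finset.sdiff_subset

/-- A pair `(x, V)` with residual of size `t` is determined by `V ∪ T x V`, the residual as a
subset of `B (V ∪ T x V)`, and `x` among the sets containing the residual. -/
theorem sum_residual_card_eq_le {α ι : Type*} [DecidableEq α] [Fintype ι] [DecidableEq ι]
    {A : ι → Finset α} {T : ι → Finset α → Finset α} {B : Finset α → Finset α}
    (hTA : ∀ x V, T x V ⊆ A x) (hTV : ∀ x V, Disjoint (T x V) V)
    (hTB : ∀ x V, T x V ⊆ B (V ∪ T x V)) (hBA : ∀ x V, (B (V ∪ T x V)).card ≤ (A x).card)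
    {N : Finset α} (hAN : ∀ x, A x ⊆ N) (v t : ℕ) {M : ℝ} (hM0 : 0 ≤ M)
    (hM : ∀ Z : Finset α, Z.card = t → ((Finset.univ.filter (fun x => Z ⊆ A x)).card : ℝ) ≤ M) :
    ∑ p ∈ (Finset.univ ×ˢ N.powersetCard v).filter (fun p => (T p.1 p.2).card = t),
      (1 / 2 : ℝ) ^ (A p.1).card ≤ (N.card.choose (v + t) : ℝ) * M := by
  set P := (Finset.univ ×ˢ N.powersetCard v).filter
    (fun p : ι × Finset α => (T p.1 p.2).card = t) with hP
  let Q := (N.powersetCard (v + t)).sigma fun R => ((B R).powersetCard t).sigma fun Z =>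
    Finset.univ.filter (fun x => Z ⊆ A x)
  let e : ι × Finset α → (_ : Finset α) × (_ : Finset α) × ι :=
    fun p => ⟨p.2 ∪ T p.1 p.2, T p.1 p.2, p.1⟩
  have he : Set.InjOn e P := by
    rintro ⟨x, V⟩ - ⟨x', V'⟩ - h
    simp only [e, Sigma.mk.injEq, heq_eq_eq] at h
    obtain ⟨hR, hZ, rfl⟩ := h
    have h1 := Finset.union_sdiff_cancel_right (hTV x V).symm
    have h2 := Finset.union_sdiff_cancel_right (hTV x V').symm
    rw [← h1, ← h2, hR, hZ]
  have hPQ : P.image e ⊆ Q := by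
    intro q hq
    obtain ⟨⟨x, V⟩, hp, rfl⟩ := Finset.mem_image.1 hq
    simp only [hP, Finset.mem_filter, Finset.mem_product, Finset.mem_univ, true_and,
      Finset.mem_powersetCard] at hp
    simp only [Q, e, Finset.mem_sigma, Finset.mem_powersetCard, Finset.mem_filter,
      Finset.mem_univ, true_and]
    refine ⟨⟨Finset.union_subset hp.1.1 ((hTA x V).trans (hAN x)), ?_⟩,
      ⟨hTB x V, hp.2⟩, hTA x V⟩
    rw [Finset.card_union_of_disjoint (hTV x V).symm, hp.1.2, hp.2]
  calc ∑ p ∈ P, (1 / 2 : ℝ) ^ (A p.1).card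
      ≤ ∑ p ∈ P, (1 / 2 : ℝ) ^ (B (e p).1).card :=
        Finset.sum_le_sum fun p _ =>
          pow_le_pow_of_le_one (by norm_num) (by norm_num) (hBA p.1 p.2)
    _ = ∑ q ∈ P.image e, (1 / 2 : ℝ) ^ (B q.1).card := by
        rw [Finset.sum_image he]
    _ ≤ ∑ q ∈ Q, (1 / 2 : ℝ) ^ (B q.1).card :=
        Finset.sum_le_sum_of_subset_of_nonneg hPQ fun _ _ _ => by positivity
    _ = ∑ R ∈ N.powersetCard (v + t), ∑ Z ∈ (B R).powersetCard t,
          ((Finset.univ.filter (fun x => Z ⊆ A x)).card : ℝ) * (1 / 2 : ℝ) ^ (B R).card := by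
        simp only [Q, Finset.sum_sigma]
        simp only [Finset.sum_const, nsmul_eq_mul]
    _ ≤ ∑ R ∈ N.powersetCard (v + t), M := by
        refine Finset.sum_le_sum fun R _ => ?_
        calc _ ≤ ∑ Z ∈ (B R).powersetCard t, M * (1 / 2 : ℝ) ^ (B R).card :=
              Finset.sum_le_sum fun Z hZ => mul_le_mul_of_nonneg_right
                (hM Z (Finset.mem_powersetCard.1 hZ).2) (by positivity)
          _ = ((B R).card.choose t : ℝ) * (M * (1 / 2 : ℝ) ^ (B R).card) := by
              rw [Finset.sum_const, Finset.card_powersetCard, nsmul_eq_mul]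
          _ ≤ (2 : ℝ) ^ (B R).card * (M * (1 / 2 : ℝ) ^ (B R).card) :=
              mul_le_mul_of_nonneg_right
                (by exact_mod_cast Nat.choose_le_two_pow _ _) (by positivity)
          _ = M := by
              rw [mul_left_comm, ← mul_pow]; norm_num
    _ = (N.card.choose (v + t) : ℝ) * M := by
        rw [Finset.sum_const, Finset.card_powersetCard, nsmul_eq_mul]

theorem choose_add_mul_pow_le (N v t : ℕ) :
    N.choose (v + t) * v ^ t ≤ N.choose v * N ^ t := by
  induction t with
  | zero => simp
  | succ t ih =>
    calc N.choose (v + (t + 1)) * v ^ (t + 1)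
        ≤ N.choose (v + t + 1) * (v + t + 1) * v ^ t := by
          rw [← add_assoc, pow_succ, mul_comm (v ^ t), ← mul_assoc]
          gcongr; omega
      _ = N.choose (v + t) * v ^ t * (N - (v + t)) := by
          rw [Nat.choose_succ_right_eq]; ring
      _ ≤ N.choose v * N ^ t * N := Nat.mul_le_mul ih (Nat.sub_le _ _)
      _ = _ := by ring

/-- If the nonempty sets `A x` are spread, then adding a random `V ⊆ N` of size at least
`16 |N| / r` shrinks the expected size of the residual by a factor `2 / 3`. -/
theorem sum_residual_card_le {α ι : Type*} [DecidableEq α] [Fintype ι] [DecidableEq ι]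
    {A : ι → Finset α} {T : ι → Finset α → Finset α} {B : Finset α → Finset α}
    (hTA : ∀ x V, T x V ⊆ A x) (hTV : ∀ x V, Disjoint (T x V) V)
    (hTB : ∀ x V, T x V ⊆ B (V ∪ T x V)) (hBA : ∀ x V, (B (V ∪ T x V)).card ≤ (A x).card)
    {N : Finset α} (hAN : ∀ x, A x ⊆ N) (hA : ∀ x, 1 ≤ (A x).card) {v : ℕ} {r : ℝ} (hr : 0 < r)
    (hv : 0 < v) (hvr : 16 * (N.card : ℝ) ≤ r * v)
    (hM : ∀ Z : Finset α, ((Finset.univ.filter (fun x => Z ⊆ A x)).card : ℝ) * r ^ Z.card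
      ≤ Fintype.card ι) :
    ∑ x, ∑ V ∈ N.powersetCard v, ((T x V).card : ℝ) ≤
      2 / 3 * (N.card.choose v : ℝ) * ∑ x, ((A x).card : ℝ) := by
  set L : ℝ := (Fintype.card ι : ℝ)
  set C : ℝ := (N.card.choose v : ℝ)
  set P := (Finset.univ : Finset ι) ×ˢ N.powersetCard v
  have hfib : ∀ t, ∑ p ∈ P with (T p.1 p.2).card = t, (1 / 2 : ℝ) ^ (A p.1).card ≤
      C * L * (1 / 16) ^ t := by
    intro t
    refine (sum_residual_card_eq_le hTA hTV hTB hBA hAN v t (M := L / r ^ t) (by positivity)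
      ?_).trans ?_
    · rintro Z rfl
      rw [le_div_iff₀ (by positivity)]
      exact hM Z
    · have h1 : (N.card.choose (v + t) : ℝ) * (v : ℝ) ^ t ≤ C * (N.card : ℝ) ^ t := by
        simp only [C]
        exact_mod_cast choose_add_mul_pow_le N.card v t
      have hv' : (0 : ℝ) < v := by exact_mod_cast hv
      have h2 : (16 : ℝ) ^ t * (N.card : ℝ) ^ t ≤ r ^ t * (v : ℝ) ^ t := by
        rw [← mul_pow, ← mul_pow]; gcongr
      have h3 : (N.card.choose (v + t) : ℝ) * 16 ^ t ≤ C * r ^ t := by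
        have hvt : (0 : ℝ) < (v : ℝ) ^ t := by positivity
        refine le_of_mul_le_mul_right ?_ hvt
        calc _ = (N.card.choose (v + t) : ℝ) * (v : ℝ) ^ t * 16 ^ t := by ring
          _ ≤ C * (N.card : ℝ) ^ t * 16 ^ t := by gcongr
          _ = C * (16 ^ t * (N.card : ℝ) ^ t) := by ring
          _ ≤ C * (r ^ t * (v : ℝ) ^ t) := by gcongr
          _ = _ := by ring
      rw [one_div, inv_pow, ← div_eq_mul_inv, ← mul_div_assoc,
        div_le_div_iff₀ (by positivity) (by positivity)]
      calc _ = (N.card.choose (v + t) : ℝ) * 16 ^ t * L := by ring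
        _ ≤ C * r ^ t * L := by gcongr
        _ = _ := by ring
  have hmgf : ∑ p ∈ P, (8 : ℝ) ^ (T p.1 p.2).card * (1 / 4) ^ (A p.1).card ≤ C * L := by
    let K := P.sup (fun p => (T p.1 p.2).card) + 1
    have hK : ∀ p ∈ P, (T p.1 p.2).card ∈ Finset.range K := fun p hp =>
      Finset.mem_range.2 (Nat.lt_succ_of_le
        (Finset.le_sup (f := fun p : ι × Finset α => (T p.1 p.2).card) hp))
    calc _ ≤ ∑ p ∈ P, (8 : ℝ) ^ (T p.1 p.2).card * (1 / 2 * (1 / 2) ^ (A p.1).card) := by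
          refine Finset.sum_le_sum fun p _ => mul_le_mul_of_nonneg_left ?_ (by positivity)
          have h : (1 / 4 : ℝ) ^ (A p.1).card =
              (1 / 2) ^ (A p.1).card * (1 / 2) ^ (A p.1).card := by
            rw [← mul_pow]; norm_num
          rw [h]
          refine mul_le_mul_of_nonneg_right ?_ (by positivity)
          simpa using pow_le_pow_of_le_one (a := (1 / 2 : ℝ)) (by norm_num) (by norm_num)
            (hA p.1)
      _ = ∑ t ∈ Finset.range K, ∑ p ∈ P with (T p.1 p.2).card = t,
            (8 : ℝ) ^ (T p.1 p.2).card * (1 / 2 * (1 / 2) ^ (A p.1).card) :=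
          (Finset.sum_fiberwise_of_maps_to hK _).symm
      _ = ∑ t ∈ Finset.range K, 1 / 2 * 8 ^ t *
            ∑ p ∈ P with (T p.1 p.2).card = t, (1 / 2 : ℝ) ^ (A p.1).card := by
          refine Finset.sum_congr rfl fun t _ => ?_
          rw [Finset.mul_sum]
          refine Finset.sum_congr rfl fun p hp => ?_
          rw [(Finset.mem_filter.1 hp).2]; ring
      _ ≤ ∑ t ∈ Finset.range K, 1 / 2 * 8 ^ t * (C * L * (1 / 16) ^ t) := by
          gcongr with t _; exact hfib t
      _ = C * L / 2 * ∑ t ∈ Finset.range K, (1 / 2 : ℝ) ^ t := by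
          rw [Finset.mul_sum]
          refine Finset.sum_congr rfl fun t _ => ?_
          have h : (1 / 2 : ℝ) ^ t = 8 ^ t * (1 / 16) ^ t := by
            rw [← mul_pow]; norm_num
          rw [h]; ring
      _ ≤ C * L / 2 * 2 := by gcongr; exact sum_geometric_two_le K
      _ = C * L := by ring
  have hlin : ∀ p ∈ P, 1 + (3 * ((T p.1 p.2).card : ℝ) - 2 * (A p.1).card) * Real.log 2 ≤
      (8 : ℝ) ^ (T p.1 p.2).card * (1 / 4) ^ (A p.1).card := by
    intro p _
    have h8 : (8 : ℝ) = Real.exp (3 * Real.log 2) := by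
      rw [mul_comm, Real.exp_mul, Real.exp_log (by norm_num)]; norm_num
    have h4 : (1 / 4 : ℝ) = Real.exp (-2 * Real.log 2) := by
      rw [mul_comm, Real.exp_mul, Real.exp_log (by norm_num)]
      norm_num [Real.rpow_neg]
    rw [h8, h4, ← Real.exp_nat_mul, ← Real.exp_nat_mul, ← Real.exp_add]
    refine le_trans (le_of_eq ?_) (Real.add_one_le_exp _)
    ring
  have hsum := (Finset.sum_le_sum hlin).trans hmgf
  have hPc : (P.card : ℝ) = C * L := by
    simp [P, C, L, mul_comm]
  rw [Finset.sum_add_distrib, Finset.sum_const, nsmul_eq_mul, mul_one, hPc,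
    ← Finset.sum_mul, Finset.sum_sub_distrib, ← Finset.mul_sum, ← Finset.mul_sum] at hsum
  have hlog : 0 < Real.log 2 := Real.log_pos (by norm_num)
  have hle : 3 * ∑ p ∈ P, ((T p.1 p.2).card : ℝ) - 2 * ∑ p ∈ P, ((A p.1).card : ℝ) ≤ 0 := by
    by_contra! h
    nlinarith [mul_pos h hlog]
  have e1 : ∑ p ∈ P, ((T p.1 p.2).card : ℝ) =
      ∑ x, ∑ V ∈ N.powersetCard v, ((T x V).card : ℝ) := Finset.sum_product _ _ _
  have e2 : ∑ p ∈ P, ((A p.1).card : ℝ) = C * ∑ x, ((A x).card : ℝ) := by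
    rw [Finset.sum_product, Finset.mul_sum]
    simp [C]
  rw [e1, e2] at hle
  linarith

theorem exists_chiCard_eq {n ℓ : ℕ} (S : Fin ℓ → Finset (Fin n)) (x : Fin ℓ)
    (W : Finset (Fin n)) : ∃ y, S y ⊆ S x ∪ W ∧ (S y \ W).card = chiCard S x W :=
  Nat.sInf_mem (s := {m : ℕ | ∃ y : Fin ℓ, S y ⊆ S x ∪ W ∧ (S y \ W).card = m})
    ⟨_, x, Finset.subset_union_left, rfl⟩

theorem chiCard_le {n ℓ : ℕ} {S : Fin ℓ → Finset (Fin n)} {x y : Fin ℓ}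
    {W : Finset (Fin n)} (h : S y ⊆ S x ∪ W) : chiCard S x W ≤ (S y \ W).card :=
  Nat.sInf_le ⟨y, h, rfl⟩

theorem sum_chiCard_union_le {n ℓ : ℕ} (S : Fin ℓ → Finset (Fin n)) {r : ℝ} (hr : 0 < r)
    (hS : ∀ Z : Finset (Fin n),
      ((Finset.univ.filter (fun x => Z ⊆ S x)).card : ℝ) * r ^ Z.card ≤ ℓ)
    (U : Finset (Fin n)) {v : ℕ} (hv : 0 < v) (hvr : 16 * (n : ℝ) ≤ r * v) :
    ∑ x, ∑ V ∈ Uᶜ.powersetCard v, (chiCard S x (U ∪ V) : ℝ) ≤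
      2 / 3 * (Uᶜ.card.choose v : ℝ) * ∑ x, (chiCard S x U : ℝ) := by
  choose Y hY hYc using fun x => exists_chiCard_eq S x U
  by_cases h0 : ∃ x, chiCard S x U = 0
  · obtain ⟨x, hx⟩ := h0
    have hsub : S (Y x) ⊆ U := by
      rw [← Finset.sdiff_eq_empty_iff_subset, ← Finset.card_eq_zero, hYc, hx]
    have hz : ∀ z V, chiCard S z (U ∪ V) = 0 := by
      intro z V
      have hs : S (Y x) ⊆ U ∪ V := hsub.trans Finset.subset_union_left
      have := chiCard_le (hs.trans (Finset.subset_union_right (s₁ := S z)))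
      rwa [Finset.sdiff_eq_empty_iff_subset.2 hs, Finset.card_empty, Nat.le_zero] at this
    simp only [hz, Nat.cast_zero, Finset.sum_const_zero]
    positivity
  push Not at h0
  have hAS : ∀ x, S (Y x) \ U ⊆ S x := fun x =>
    sdiff_le_iff.2 (by rw [sup_comm]; exact hY x)
  obtain ⟨T, B, hTB⟩ := exists_residual fun x => S (Y x) \ U
  have hmain := sum_residual_card_le (A := fun x => S (Y x) \ U) (T := T) (B := B) (N := Uᶜ)
    (fun x V => (hTB x V).1) (fun x V => (hTB x V).2.1) (fun x V => (hTB x V).2.2.1)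
    (fun x V => (hTB x V).2.2.2.1)
    (fun x => by
      rw [Finset.subset_compl_iff_disjoint_right]; exact Finset.sdiff_disjoint)
    (fun x => by rw [hYc]; exact Nat.one_le_iff_ne_zero.2 (h0 x)) hr hv
    (by
      refine le_trans ?_ hvr
      have : (Uᶜ.card : ℝ) ≤ n := by
        exact_mod_cast (Finset.card_le_univ _).trans (Fintype.card_fin n).le
      linarith)
    (fun Z => by
      rw [Fintype.card_fin]
      refine le_trans ?_ (hS Z)
      refine mul_le_mul_of_nonneg_right (Nat.cast_le.2 (Finset.card_le_card ?_)) (by positivity)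
      exact Finset.monotone_filter_right _ fun x _ h => h.trans (hAS x))
  simp only [hYc] at hmain
  refine le_trans ?_ hmain
  gcongr with x _ V _
  obtain ⟨hTA, -, -, -, y, hy, hyT⟩ := hTB x V
  have h1 : S (Y y) ⊆ S x ∪ (U ∪ V) := by
    intro i hi
    by_cases hiU : i ∈ U
    · simp [hiU]
    · have := hy (Finset.mem_sdiff.2 ⟨hi, hiU⟩)
      rcases Finset.mem_union.1 this with h | h
      · simp [hAS x h]
      · simp [h]
  refine (chiCard_le h1).trans (le_of_eq ?_)
  rw [← hyT]
  congr 1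
  ext i
  simp [and_assoc]

theorem sum_powersetCard_sum_compl {α : Type*} [Fintype α] [DecidableEq α] (F : Finset α → ℝ)
    (u v : ℕ) :
    ∑ U ∈ (Finset.univ : Finset α).powersetCard u, ∑ V ∈ Uᶜ.powersetCard v, F (U ∪ V) =
      ((u + v).choose u : ℝ) * ∑ W ∈ (Finset.univ : Finset α).powersetCard (u + v), F W := by
  have h : ((u + v).choose u : ℝ) * ∑ W ∈ (Finset.univ : Finset α).powersetCard (u + v), F W =
      ∑ W ∈ (Finset.univ : Finset α).powersetCard (u + v), ∑ U ∈ W.powersetCard u, F W := by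
    rw [Finset.mul_sum]
    refine Finset.sum_congr rfl fun W hW => ?_
    rw [Finset.sum_const, Finset.card_powersetCard, (Finset.mem_powersetCard.1 hW).2,
      nsmul_eq_mul]
  rw [h, Finset.sum_sigma', Finset.sum_sigma']
  refine Finset.sum_nbij' (fun p => ⟨p.1 ∪ p.2, p.1⟩) (fun q => ⟨q.2, q.1 \ q.2⟩) ?_ ?_ ?_ ?_ ?_
  · rintro ⟨U, V⟩ hp
    simp only [Finset.mem_sigma, Finset.mem_powersetCard,
      Finset.subset_compl_iff_disjoint_left] at hp ⊢
    exact ⟨⟨Finset.subset_univ _, by rw [Finset.card_union_of_disjoint hp.2.1, hp.1.2, hp.2.2]⟩,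
      Finset.subset_union_left, hp.1.2⟩
  · rintro ⟨W, U⟩ hp
    simp only [Finset.mem_sigma, Finset.mem_powersetCard,
      Finset.subset_compl_iff_disjoint_left] at hp ⊢
    refine ⟨⟨Finset.subset_univ _, hp.2.2⟩, Finset.disjoint_sdiff, ?_⟩
    rw [Finset.card_sdiff_of_subset hp.2.1, hp.1.2, hp.2.2, Nat.add_sub_cancel_left]
  · rintro ⟨U, V⟩ hp
    simp only [Finset.mem_sigma, Finset.mem_powersetCard,
      Finset.subset_compl_iff_disjoint_left] at hp
    simp only [Finset.union_sdiff_cancel_left hp.2.1]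
  · rintro ⟨W, U⟩ hp
    simp only [Finset.mem_sigma, Finset.mem_powersetCard] at hp
    simp only [Finset.union_sdiff_of_subset hp.2.1]
  · intro p _
    rfl

/-- The ground set of a spread sequence of `ℓ` sets of size `k` has at least `k * r` elements. -/
theorem mul_le_card_of_spread {n ℓ k : ℕ} {S : Fin ℓ → Finset (Fin n)} {r : ℝ} (hℓ : 0 < ℓ)
    (hk : ∀ i, (S i).card = k)
    (hS : ∀ Z : Finset (Fin n),
      ((Finset.univ.filter (fun x => Z ⊆ S x)).card : ℝ) * r ^ Z.card ≤ ℓ) : k * r ≤ n := by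
  have hdouble : ∑ i : Fin n, (Finset.univ.filter (fun x => i ∈ S x)).card = ℓ * k := by
    have h := Finset.sum_card_bipartiteAbove_eq_sum_card_bipartiteBelow
      (s := (Finset.univ : Finset (Fin n))) (t := (Finset.univ : Finset (Fin ℓ)))
      (fun i x => i ∈ S x)
    simp only [Finset.bipartiteAbove, Finset.bipartiteBelow, Finset.filter_univ_mem, hk,
      Finset.sum_const, Finset.card_univ, Fintype.card_fin, smul_eq_mul] at h
    exact h
  have h2 : ((ℓ * k : ℕ) : ℝ) * r ≤ n * ℓ := by
    rw [← hdouble, Nat.cast_sum, Finset.sum_mul]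
    calc _ ≤ ∑ i : Fin n, (ℓ : ℝ) := Finset.sum_le_sum fun i _ => by
          simpa using hS {i}
      _ = n * ℓ := by simp
  have hℓ' : (0 : ℝ) < ℓ := by exact_mod_cast hℓ
  refine le_of_mul_le_mul_right ?_ hℓ'
  push_cast at h2
  linarith

theorem sum_chiCard_le {n ℓ k : ℕ} {S : Fin ℓ → Finset (Fin n)} {r : ℝ} (hr : 0 < r)
    (hn : r ≤ n) (hk : ∀ i, (S i).card = k)
    (hS : ∀ Z : Finset (Fin n),
      ((Finset.univ.filter (fun x => Z ⊆ S x)).card : ℝ) * r ^ Z.card ≤ ℓ)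
    (m w : ℕ) (hw : 32 * m * n / r ≤ (w : ℝ)) (hwn : w ≤ n) :
    ∑ x, ∑ W ∈ Finset.powersetCard w (Finset.univ : Finset (Fin n)), (chiCard S x W : ℝ) ≤
      (ℓ : ℝ) * (n.choose w : ℝ) * (k * (2 / 3) ^ m) := by
  induction m generalizing w with
  | zero =>
    calc _ ≤ ∑ x : Fin ℓ, ∑ W ∈ Finset.powersetCard w (Finset.univ : Finset (Fin n)),
          (k : ℝ) := by
          gcongr with x _ W _
          rw [← hk x]
          exact (chiCard_le Finset.subset_union_left).trans (Finset.card_le_card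
            Finset.sdiff_subset)
      _ = _ := by simp; ring
  | succ m ih =>
    have hnr : 1 ≤ (n : ℝ) / r := (one_le_div hr).2 hn
    set u := ⌈32 * (m : ℝ) * n / r⌉₊
    have hu : 32 * (m : ℝ) * n / r ≤ u := Nat.le_ceil _
    have hu' : (u : ℝ) < 32 * (m : ℝ) * n / r + 1 := Nat.ceil_lt_add_one (by positivity)
    have hw' : 32 * (m : ℝ) * n / r + 32 * (n / r) ≤ w := by
      refine le_trans (le_of_eq ?_) hw
      push_cast; ring
    have huw : u < w := by
      have : (u : ℝ) < w := by linarith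
      exact_mod_cast this
    obtain ⟨v, rfl⟩ := Nat.exists_eq_add_of_le huw.le
    have hv : 0 < v := by omega
    push_cast at hw'
    have hvr : 16 * (n : ℝ) ≤ r * v := by
      have : 16 * ((n : ℝ) / r) ≤ v := by linarith
      rw [← mul_div_assoc, div_le_iff₀ hr] at this
      linarith
    have hC : (0 : ℝ) < ((u + v).choose u : ℝ) := by
      exact_mod_cast Nat.choose_pos (Nat.le_add_right u v)
    refine le_of_mul_le_mul_left ?_ hC
    have hchoose : ((u + v).choose u : ℝ) * (n.choose (u + v) : ℝ) =
        (n.choose u : ℝ) * ((n - u).choose v : ℝ) := by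
      have := Nat.choose_mul (n := n) (k := u + v) (s := u) (Nat.le_add_right u v)
      rw [Nat.add_sub_cancel_left] at this
      rw [mul_comm]
      exact_mod_cast this
    calc _ = ∑ U ∈ Finset.powersetCard u (Finset.univ : Finset (Fin n)),
          ∑ x, ∑ V ∈ Uᶜ.powersetCard v, (chiCard S x (U ∪ V) : ℝ) := by
          rw [Finset.mul_sum, Finset.sum_comm]
          exact Finset.sum_congr rfl fun x _ =>
            (sum_powersetCard_sum_compl (fun W => (chiCard S x W : ℝ)) u v).symm
      _ ≤ ∑ U ∈ Finset.powersetCard u (Finset.univ : Finset (Fin n)),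
          2 / 3 * ((n - u).choose v : ℝ) * ∑ x, (chiCard S x U : ℝ) := by
          refine Finset.sum_le_sum fun U hU => ?_
          have := sum_chiCard_union_le S hr hS U hv hvr
          rwa [Finset.card_compl, Fintype.card_fin, (Finset.mem_powersetCard.1 hU).2] at this
      _ = 2 / 3 * ((n - u).choose v : ℝ) *
          ∑ x, ∑ U ∈ Finset.powersetCard u (Finset.univ : Finset (Fin n)),
            (chiCard S x U : ℝ) := by
          rw [← Finset.mul_sum, Finset.sum_comm]
      _ ≤ 2 / 3 * ((n - u).choose v : ℝ) * ((ℓ : ℝ) * (n.choose u : ℝ) * (k * (2 / 3) ^ m)) := by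
          gcongr
          exact ih u hu (by omega)
      _ = ((n.choose u : ℝ) * ((n - u).choose v : ℝ)) * ((ℓ : ℝ) * (k * (2 / 3) ^ (m + 1))) := by
          ring
      _ = _ := by rw [← hchoose]; ring

/-- **Inductive step of the proof of the main lemma.**
There are universal constants `β > 1` and `κ > 1` such that: for `0 < γ < 1/2`,
`0 < ε < 1/2`, positive integers `k, n`, and `r = β * (1/γ) * log₂ (k/ε)`, if
`S : Fin ℓ → Finset (Fin n)` is an `r`-spread sequence of `ℓ = ⌈r ^ k⌉` sets of size
exactly `k`, then for every integer `0 ≤ m ≤ r * γ / κ`, if `X` is uniform on `[ℓ]` and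
`W ⊆ [n]` is an independent uniformly random set of a fixed size `w ≥ κ * m * n / r`,
then `E[f(X, W)] ≤ k * (2/3) ^ m`.  The expectation is written as an average. -/
theorem expected_chi_decay :
    ∃ β κ : ℝ, 1 < β ∧ 1 < κ ∧
      ∀ (γ ε r : ℝ) (k n ℓ : ℕ) (S : Fin ℓ → Finset (Fin n)),
        0 < γ → γ < 1/2 → 0 < ε → ε < 1/2 → 0 < k → 0 < n →
        r = β * (1/γ) * Real.logb 2 (k / ε) →
        ℓ = ⌈r ^ k⌉₊ →
        (∀ i, (S i).card = k) →
        -- the sequence is r-spread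
        (∀ Z : Finset (Fin n), Z.Nonempty →
          (((Finset.univ.filter (fun i : Fin ℓ => Z ⊆ S i)).card : ℝ) ≤ r ^ (k - Z.card))) →
        ∀ m : ℕ, (m : ℝ) ≤ r * γ / κ →
          ∀ w : ℕ, κ * m * n / r ≤ (w : ℝ) → w ≤ n →
            (∑ x : Fin ℓ, ∑ W ∈ Finset.powersetCard w (Finset.univ : Finset (Fin n)),
                (chiCard S x W : ℝ)) /
              ((ℓ : ℝ) * ((Finset.powersetCard w (Finset.univ : Finset (Fin n))).card : ℝ))
              ≤ (k : ℝ) * (2/3) ^ m := by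
  refine ⟨2, 32, by norm_num, by norm_num, ?_⟩
  intro γ ε r k n ℓ S hγ _ hε hε' hk _ hr hℓ hcard hspread m _ w hw hwn
  have hk1 : (1 : ℝ) ≤ k := by exact_mod_cast hk
  have hr0 : 0 < r := by
    have h1 : 1 < (k : ℝ) / ε := by rw [one_lt_div hε]; linarith
    have h2 : 0 < Real.logb 2 (k / ε) := Real.logb_pos (by norm_num) h1
    rw [hr]; positivity
  have hrℓ : r ^ k ≤ ℓ := hℓ ▸ Nat.le_ceil _
  have hℓ0 : 0 < ℓ := by rw [hℓ, Nat.ceil_pos]; positivity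
  have hS : ∀ Z : Finset (Fin n),
      ((Finset.univ.filter (fun x => Z ⊆ S x)).card : ℝ) * r ^ Z.card ≤ ℓ := by
    intro Z
    rcases Z.eq_empty_or_nonempty with rfl | hZ
    · simp
    rcases le_or_gt Z.card k with hZk | hZk
    · calc _ ≤ r ^ (k - Z.card) * r ^ Z.card := by gcongr; exact hspread Z hZ
        _ = r ^ k := by rw [← pow_add, Nat.sub_add_cancel hZk]
        _ ≤ ℓ := hrℓ
    · have h0 : Finset.univ.filter (fun x => Z ⊆ S x) = ∅ := by
        refine Finset.filter_eq_empty_iff.2 fun x _ hx => ?_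
        have := Finset.card_le_card hx
        rw [hcard] at this
        omega
      rw [h0]; simp
  have hn : r ≤ n := by
    have := mul_le_card_of_spread hℓ0 hcard hS
    nlinarith
  have hℓ' : (0 : ℝ) < ℓ := by exact_mod_cast hℓ0
  have hC : (0 : ℝ) < (n.choose w : ℝ) := by exact_mod_cast Nat.choose_pos hwn
  rw [Finset.card_powersetCard, Finset.card_univ, Fintype.card_fin,
    div_le_iff₀ (by positivity), mul_comm _ ((ℓ : ℝ) * _)]
  exact sum_chiCard_le hr0 hn hcard hS m w hw hwn
end
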